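/- arXiv:1706.04104 — 4 statements merged into one kernel-verified Lean document; each statement's English description precedes it below -/
import Mathlib

section
/- Let a ∈ ℝ, b ≠ 0 and ε > 0, and define X(x,y,t) = x + a y + (a² − 3b²) t, Y(y,t) = y + 2 a t, and u(x,y,t) = 24 (−X²/ε² + 3 b² Y²/ε² + 1/b²) / (X²/ε² + 3 b² Y²/ε² + 1/b²)². Then u is an exact solution of the KPI equation, i.e. ∂_x(∂_t u + u ∂_x u + ε² ∂_x³ u) − ∂_y² u = 0 at every (x,y,t) ∈ ℝ³. -/
/-- Partial derivative with respect to the first variable `x`. -/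
noncomputable def pdx (u : ℝ → ℝ → ℝ → ℝ) : ℝ → ℝ → ℝ → ℝ :=
  fun x y t => deriv (fun x' => u x' y t) x

/-- Partial derivative with respect to the second variable `y`. -/
noncomputable def pdy (u : ℝ → ℝ → ℝ → ℝ) : ℝ → ℝ → ℝ → ℝ :=
  fun x y t => deriv (fun y' => u x y' t) y

/-- Partial derivative with respect to the third variable `t`. -/
noncomputable def pdt (u : ℝ → ℝ → ℝ → ℝ) : ℝ → ℝ → ℝ → ℝ :=
  fun x y t => deriv (fun t' => u x y t') t

/-- `u` solves the KPI equation `∂ₓ(u_t + u u_x + ε² u_xxx) − u_yy = 0`. -/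
def IsKPISolution (ε : ℝ) (u : ℝ → ℝ → ℝ → ℝ) : Prop :=
  ∀ x y t : ℝ,
    pdx (fun x y t =>
        pdt u x y t + u x y t * pdx u x y t + ε ^ 2 * pdx (pdx (pdx u)) x y t) x y t
      - pdy (pdy u) x y t = 0

/-- The phase `X = x + a y + (a² - 3b²) t` of the lump. -/
noncomputable def lumpPhase (a b x y t : ℝ) : ℝ :=
  x + a * y + (a ^ 2 - 3 * b ^ 2) * t

/-- The tau function `X² + 3b²Y² + ε²/b²` of the lump, with `Y = y + 2at`; the lump is
`12 ε²` times the second `x`-derivative of its logarithm. -/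
noncomputable def lumpTau (a b ε x y t : ℝ) : ℝ :=
  lumpPhase a b x y t ^ 2 + 3 * b ^ 2 * (y + 2 * a * t) ^ 2 + ε ^ 2 / b ^ 2

lemma lumpTau_pos {a b ε : ℝ} (hb : b ≠ 0) (hε : 0 < ε) (x y t : ℝ) :
    0 < lumpTau a b ε x y t := by
  unfold lumpTau
  positivity

lemma HasDerivAt.div_pow_self {P F : ℝ → ℝ} {P' F' s : ℝ} (hP : HasDerivAt P P' s)
    (hF : HasDerivAt F F' s) (h0 : F s ≠ 0) (n : ℕ) :
    HasDerivAt (fun r => P r / F r ^ n) (P' / F s ^ n - n * P s * F' / F s ^ (n + 1)) s := by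
  refine (hP.fun_div (hF.fun_pow n) (pow_ne_zero n h0)).congr_deriv ?_
  rcases n with _ | n
  · simp
  · simp only [Nat.add_sub_cancel]
    field_simp
    ring

section Derivatives

variable (a b ε x y t : ℝ)

lemma hasDerivAt_lumpPhase_x : HasDerivAt (fun r => lumpPhase a b r y t) 1 x :=
  ((hasDerivAt_id x).add_const _).add_const _

lemma hasDerivAt_lumpPhase_y : HasDerivAt (fun r => lumpPhase a b x r t) a y :=
  ((((hasDerivAt_id y).const_mul a).const_add x).add_const _).congr_deriv (mul_one a)

lemma hasDerivAt_lumpPhase_t :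
    HasDerivAt (fun r => lumpPhase a b x y r) (a ^ 2 - 3 * b ^ 2) t :=
  (((hasDerivAt_id t).const_mul _).const_add _).congr_deriv (mul_one _)

lemma hasDerivAt_lumpTau_x :
    HasDerivAt (fun r => lumpTau a b ε r y t) (2 * lumpPhase a b x y t) x := by
  refine ((((hasDerivAt_lumpPhase_x a b x y t).fun_pow 2).add_const
    (3 * b ^ 2 * (y + 2 * a * t) ^ 2)).add_const (ε ^ 2 / b ^ 2)).congr_deriv ?_
  norm_num

lemma hasDerivAt_lumpTau_y :
    HasDerivAt (fun r => lumpTau a b ε x r t)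
      (2 * a * lumpPhase a b x y t + 6 * b ^ 2 * (y + 2 * a * t)) y := by
  refine ((((hasDerivAt_lumpPhase_y a b x y t).fun_pow 2).fun_add
    ((((hasDerivAt_id y).add_const (2 * a * t)).fun_pow 2).const_mul (3 * b ^ 2))).add_const
    (ε ^ 2 / b ^ 2)).congr_deriv ?_
  norm_num
  ring

lemma hasDerivAt_lumpTau_t :
    HasDerivAt (fun r => lumpTau a b ε x y r)
      (2 * (a ^ 2 - 3 * b ^ 2) * lumpPhase a b x y t + 12 * a * b ^ 2 * (y + 2 * a * t)) t := by
  refine ((((hasDerivAt_lumpPhase_t a b x y t).fun_pow 2).fun_add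
    (((((hasDerivAt_id t).const_mul (2 * a)).const_add y).fun_pow 2).const_mul
      (3 * b ^ 2))).add_const (ε ^ 2 / b ^ 2)).congr_deriv ?_
  norm_num
  ring

end Derivatives

/-- The lump in terms of its phase and tau function. -/
noncomputable def lump (a b ε x y t : ℝ) : ℝ :=
  24 * ε ^ 2 * (1 / lumpTau a b ε x y t ^ 1
    - 2 * lumpPhase a b x y t ^ 2 / lumpTau a b ε x y t ^ 2)

lemma pdx_lump {a b ε : ℝ} (hb : b ≠ 0) (hε : 0 < ε) :
    pdx (lump a b ε) = fun x y t =>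
      24 * ε ^ 2 * (8 * lumpPhase a b x y t ^ 3 / lumpTau a b ε x y t ^ 3
        - 6 * lumpPhase a b x y t / lumpTau a b ε x y t ^ 2) := by
  funext x y t
  have h0 := (lumpTau_pos (a := a) hb hε x y t).ne'
  have hX := hasDerivAt_lumpPhase_x a b x y t
  have hF := hasDerivAt_lumpTau_x a b ε x y t
  refine HasDerivAt.deriv ?_
  refine ((((hasDerivAt_const _ 1).div_pow_self hF h0 1).fun_sub
    (((hX.fun_pow 2).const_mul 2).div_pow_self hF h0 2)).const_mul
    (24 * ε ^ 2)).congr_deriv ?_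
  push_cast
  field_simp
  ring

lemma pdx_pdx_lump {a b ε : ℝ} (hb : b ≠ 0) (hε : 0 < ε) :
    pdx (pdx (lump a b ε)) = fun x y t =>
      24 * ε ^ 2 * (48 * lumpPhase a b x y t ^ 2 / lumpTau a b ε x y t ^ 3
        - 48 * lumpPhase a b x y t ^ 4 / lumpTau a b ε x y t ^ 4
        - 6 / lumpTau a b ε x y t ^ 2) := by
  funext x y t
  rw [pdx_lump hb hε]
  have h0 := (lumpTau_pos (a := a) hb hε x y t).ne'
  have hX := hasDerivAt_lumpPhase_x a b x y t
  have hF := hasDerivAt_lumpTau_x a b ε x y t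
  refine HasDerivAt.deriv ?_
  refine (((((hX.fun_pow 3).const_mul 8).div_pow_self hF h0 3).fun_sub
    ((hX.const_mul 6).div_pow_self hF h0 2)).const_mul
    (24 * ε ^ 2)).congr_deriv ?_
  push_cast
  field_simp
  ring

lemma pdx_pdx_pdx_lump {a b ε : ℝ} (hb : b ≠ 0) (hε : 0 < ε) :
    pdx (pdx (pdx (lump a b ε))) = fun x y t =>
      24 * ε ^ 2 * (120 * lumpPhase a b x y t / lumpTau a b ε x y t ^ 3
        - 480 * lumpPhase a b x y t ^ 3 / lumpTau a b ε x y t ^ 4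
        + 384 * lumpPhase a b x y t ^ 5 / lumpTau a b ε x y t ^ 5) := by
  funext x y t
  rw [pdx_pdx_lump hb hε]
  have h0 := (lumpTau_pos (a := a) hb hε x y t).ne'
  have hX := hasDerivAt_lumpPhase_x a b x y t
  have hF := hasDerivAt_lumpTau_x a b ε x y t
  refine HasDerivAt.deriv ?_
  refine ((((((hX.fun_pow 2).const_mul 48).div_pow_self hF h0 3).fun_sub
    (((hX.fun_pow 4).const_mul 48).div_pow_self hF h0 4)).fun_sub
    ((hasDerivAt_const _ 6).div_pow_self hF h0 2)).const_mul
    (24 * ε ^ 2)).congr_deriv ?_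
  push_cast
  field_simp
  ring

lemma pdt_lump {a b ε : ℝ} (hb : b ≠ 0) (hε : 0 < ε) :
    pdt (lump a b ε) = fun x y t =>
      24 * ε ^ 2 * (4 * lumpPhase a b x y t ^ 2
          * (2 * (a ^ 2 - 3 * b ^ 2) * lumpPhase a b x y t + 12 * a * b ^ 2 * (y + 2 * a * t))
          / lumpTau a b ε x y t ^ 3
        - ((2 * (a ^ 2 - 3 * b ^ 2) * lumpPhase a b x y t + 12 * a * b ^ 2 * (y + 2 * a * t))
          + 4 * (a ^ 2 - 3 * b ^ 2) * lumpPhase a b x y t) / lumpTau a b ε x y t ^ 2) := by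
  funext x y t
  have h0 := (lumpTau_pos (a := a) hb hε x y t).ne'
  have hX := hasDerivAt_lumpPhase_t a b x y t
  have hF := hasDerivAt_lumpTau_t a b ε x y t
  refine HasDerivAt.deriv ?_
  refine ((((hasDerivAt_const _ 1).div_pow_self hF h0 1).fun_sub
    (((hX.fun_pow 2).const_mul 2).div_pow_self hF h0 2)).const_mul
    (24 * ε ^ 2)).congr_deriv ?_
  push_cast
  field_simp
  ring

lemma pdy_lump {a b ε : ℝ} (hb : b ≠ 0) (hε : 0 < ε) :
    pdy (lump a b ε) = fun x y t =>
      24 * ε ^ 2 * (4 * lumpPhase a b x y t ^ 2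
          * (2 * a * lumpPhase a b x y t + 6 * b ^ 2 * (y + 2 * a * t))
          / lumpTau a b ε x y t ^ 3
        - ((2 * a * lumpPhase a b x y t + 6 * b ^ 2 * (y + 2 * a * t))
          + 4 * a * lumpPhase a b x y t) / lumpTau a b ε x y t ^ 2) := by
  funext x y t
  have h0 := (lumpTau_pos (a := a) hb hε x y t).ne'
  have hX := hasDerivAt_lumpPhase_y a b x y t
  have hF := hasDerivAt_lumpTau_y a b ε x y t
  refine HasDerivAt.deriv ?_
  refine ((((hasDerivAt_const _ 1).div_pow_self hF h0 1).fun_sub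
    (((hX.fun_pow 2).const_mul 2).div_pow_self hF h0 2)).const_mul
    (24 * ε ^ 2)).congr_deriv ?_
  push_cast
  field_simp
  ring

lemma pdy_pdy_lump {a b ε : ℝ} (hb : b ≠ 0) (hε : 0 < ε) :
    pdy (pdy (lump a b ε)) = fun x y t =>
      24 * ε ^ 2 * ((16 * a * lumpPhase a b x y t
            * (2 * a * lumpPhase a b x y t + 6 * b ^ 2 * (y + 2 * a * t))
          + 4 * lumpPhase a b x y t ^ 2 * (2 * a ^ 2 + 6 * b ^ 2)
          + 2 * (2 * a * lumpPhase a b x y t + 6 * b ^ 2 * (y + 2 * a * t)) ^ 2)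
          / lumpTau a b ε x y t ^ 3
        - 12 * lumpPhase a b x y t ^ 2
          * (2 * a * lumpPhase a b x y t + 6 * b ^ 2 * (y + 2 * a * t)) ^ 2
          / lumpTau a b ε x y t ^ 4
        - (6 * a ^ 2 + 6 * b ^ 2) / lumpTau a b ε x y t ^ 2) := by
  funext x y t
  rw [pdy_lump hb hε]
  have h0 := (lumpTau_pos (a := a) hb hε x y t).ne'
  have hX := hasDerivAt_lumpPhase_y a b x y t
  have hF := hasDerivAt_lumpTau_y a b ε x y t
  have hS := (hX.const_mul (2 * a)).fun_add
    (((hasDerivAt_id y).add_const (2 * a * t)).const_mul (6 * b ^ 2))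
  simp only [id_eq] at hS
  refine HasDerivAt.deriv ?_
  refine ((((((hX.fun_pow 2).const_mul 4).fun_mul hS).div_pow_self hF h0 3).fun_sub
    ((hS.fun_add (hX.const_mul (4 * a))).div_pow_self hF h0 2)).const_mul
    (24 * ε ^ 2)).congr_deriv ?_
  push_cast
  field_simp
  ring

lemma isKPISolution_lump {a b ε : ℝ} (hb : b ≠ 0) (hε : 0 < ε) :
    IsKPISolution ε (lump a b ε) := by
  intro x y t
  have h0 := (lumpTau_pos (a := a) hb hε x y t).ne'
  have hX := hasDerivAt_lumpPhase_x a b x y t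
  have hF := hasDerivAt_lumpTau_x a b ε x y t
  have hT := (hX.const_mul (2 * (a ^ 2 - 3 * b ^ 2))).add_const
    (12 * a * b ^ 2 * (y + 2 * a * t))
  have hu := (((hasDerivAt_const _ 1).div_pow_self hF h0 1).fun_sub
    (((hX.fun_pow 2).const_mul 2).div_pow_self hF h0 2)).const_mul (24 * ε ^ 2)
  have hux := ((((hX.fun_pow 3).const_mul 8).div_pow_self hF h0 3).fun_sub
    ((hX.const_mul 6).div_pow_self hF h0 2)).const_mul (24 * ε ^ 2)
  have huxxx := (((((hX.const_mul 120).div_pow_self hF h0 3).fun_sub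
    (((hX.fun_pow 3).const_mul 480).div_pow_self hF h0 4)).fun_add
    (((hX.fun_pow 5).const_mul 384).div_pow_self hF h0 5)).const_mul
    (24 * ε ^ 2)).const_mul (ε ^ 2)
  have hut := (((((hX.fun_pow 2).const_mul 4).fun_mul hT).div_pow_self hF h0 3).fun_sub
    ((hT.fun_add (hX.const_mul (4 * (a ^ 2 - 3 * b ^ 2)))).div_pow_self hF h0 2)).const_mul
    (24 * ε ^ 2)
  have hε2 : ε ^ 2 = b ^ 2 * (lumpTau a b ε x y t - lumpPhase a b x y t ^ 2
      - 3 * b ^ 2 * (y + 2 * a * t) ^ 2) := by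
    rw [lumpTau]
    field_simp
    ring
  rw [pdx_pdx_pdx_lump hb hε, pdx_lump hb hε, pdt_lump hb hε, pdy_pdy_lump hb hε]
  refine (congrArg (· - _) ((hut.fun_add (hu.fun_mul hux)).fun_add huxxx).deriv).trans ?_
  simp only [hε2]
  generalize lumpTau a b ε x y t = F at *
  generalize lumpPhase a b x y t = X at *
  push_cast
  field_simp
  ring

/-- The lump with parameters `a`, `b ≠ 0`, `ε > 0` is an exact solution of KPI. -/
theorem lump_solves_KPI (a b ε : ℝ) (hb : b ≠ 0) (hε : 0 < ε) :
    IsKPISolution ε (fun x y t =>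
      24 * (-(x + a * y + (a ^ 2 - 3 * b ^ 2) * t) ^ 2 / ε ^ 2
              + 3 * b ^ 2 * (y + 2 * a * t) ^ 2 / ε ^ 2 + 1 / b ^ 2) /
        ((x + a * y + (a ^ 2 - 3 * b ^ 2) * t) ^ 2 / ε ^ 2
              + 3 * b ^ 2 * (y + 2 * a * t) ^ 2 / ε ^ 2 + 1 / b ^ 2) ^ 2) := by
  convert isKPISolution_lump (a := a) hb hε using 1
  funext x y t
  have h0 := (lumpTau_pos (a := a) hb hε x y t).ne'
  have hD : (x + a * y + (a ^ 2 - 3 * b ^ 2) * t) ^ 2 / ε ^ 2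
      + 3 * b ^ 2 * (y + 2 * a * t) ^ 2 / ε ^ 2 + 1 / b ^ 2 = lumpTau a b ε x y t / ε ^ 2 := by
    rw [lumpTau, lumpPhase]
    field_simp
  have hN : -(x + a * y + (a ^ 2 - 3 * b ^ 2) * t) ^ 2 / ε ^ 2
      + 3 * b ^ 2 * (y + 2 * a * t) ^ 2 / ε ^ 2 + 1 / b ^ 2
      = (lumpTau a b ε x y t - 2 * lumpPhase a b x y t ^ 2) / ε ^ 2 := by
    rw [← sub_eq_zero, sub_div, ← hD, lumpPhase]
    ring
  rw [hD, hN, lump]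
  field_simp
end

section
/- Let α = 1 (KPII case), a > 0 and q, ξ ∈ ℝ, and let A₁ = [[a/3 − q², −(4/3) q a], [−q/3, a/3 − q²]] and A₂ = [[2 q, (4/3) a], [1/3, 2 q]]. Then all eigenvalues of A₁ + ξ A₂ are real; explicitly they are λ± = a/3 − q² + 2 q ξ ± (2/3) √a · |ξ − q|. Hence the KPII soliton modulation system is hyperbolic. -/
/-- The spectrum of a `2 × 2` matrix over a field whose diagonal entries both equal `m` and whose
off-diagonal entries have product `s ^ 2`. -/
theorem Matrix.spectrum_fin_two_of_mul_eq_sq {K : Type*} [Field K] {m b c s : K}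
    (h : b * c = s ^ 2) : spectrum K !![m, b; c, m] = {m + s, m - s} := by
  ext μ
  rw [spectrum.mem_iff, Matrix.isUnit_iff_isUnit_det, isUnit_iff_ne_zero, not_not,
    Matrix.det_fin_two]
  have key : (μ - m) * (μ - m) - b * c = (μ - (m + s)) * (μ - (m - s)) := by
    rw [h]; ring
  simp [Matrix.algebraMap_matrix_apply, key, sub_eq_zero]

/-- KPII case (`α = 1`): all eigenvalues of the soliton-modulation matrix pencil
`A₁ + ξ A₂` are real, explicitly `λ± = a/3 − q² + 2qξ ± (2/3)√a |ξ − q|`;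
hence the KPII soliton modulation system is hyperbolic. -/
theorem KPII_soliton_modulation_hyperbolic (a q ξ : ℝ) (ha : 0 < a) :
    spectrum ℂ
        ((!![a / 3 - q ^ 2, -(4 / 3) * q * a;
             -q / 3, a / 3 - q ^ 2] +
           ξ • !![2 * q, (4 / 3) * a;
                  1 / 3, 2 * q]).map (Complex.ofReal)) =
      {((a / 3 - q ^ 2 + 2 * q * ξ + (2 / 3) * Real.sqrt a * |ξ - q| : ℝ) : ℂ),
       ((a / 3 - q ^ 2 + 2 * q * ξ - (2 / 3) * Real.sqrt a * |ξ - q| : ℝ) : ℂ)} := by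
  have hsq : ((4 / 3 * a * (ξ - q) : ℝ) : ℂ) * ((1 / 3 * (ξ - q) : ℝ) : ℂ) =
      ((2 / 3 * Real.sqrt a * |ξ - q| : ℝ) : ℂ) ^ 2 := by
    norm_cast
    rw [mul_pow, mul_pow, Real.sq_sqrt ha.le, sq_abs]
    ring
  rw [Complex.ofReal_add _ (2 / 3 * Real.sqrt a * |ξ - q|),
    Complex.ofReal_sub _ (2 / 3 * Real.sqrt a * |ξ - q|),
    ← Matrix.spectrum_fin_two_of_mul_eq_sq hsq]
  congr 1
  ext i j
  fin_cases i <;> fin_cases j <;> simp <;> ring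
end

section
/- Let α = −1 (KPI case), a > 0 and q, ξ ∈ ℝ with ξ ≠ q, and let A₁ = [[a/3 + q², (4/3) q a], [−q/3, a/3 + q²]] and A₂ = [[−2 q, −(4/3) a], [1/3, −2 q]]. Then A₁ + ξ A₂ has no real eigenvalue: its eigenvalues over ℂ are the non-real complex-conjugate pair λ± = a/3 + q² − 2 q ξ ± (2 i/3) √a (ξ − q). Hence the KPI soliton modulation system is elliptic. -/
/-- A complex `2 × 2` matrix has `μ` in its spectrum iff `μ` is a root of the characteristic
polynomial. -/
theorem mem_spectrum_fin_two_iff (M : Matrix (Fin 2) (Fin 2) ℂ) (μ : ℂ) :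
    μ ∈ spectrum ℂ M ↔ (μ - M 0 0) * (μ - M 1 1) - M 0 1 * M 1 0 = 0 := by
  rw [spectrum.mem_iff, Matrix.isUnit_iff_isUnit_det, isUnit_iff_ne_zero, not_not,
    Matrix.det_fin_two]
  simp [Matrix.algebraMap_matrix_apply]

/-- The complex spectrum of the pencil `A₁ + ξ A₂` for `α = −1`. -/
theorem spectrum_pencil (a q ξ : ℝ) (ha : 0 ≤ a) :
    spectrum ℂ
        ((!![a / 3 + q ^ 2, (4 / 3) * q * a;
             -q / 3, a / 3 + q ^ 2] +
           ξ • !![-2 * q, -(4 / 3) * a;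
                  1 / 3, -2 * q]).map (Complex.ofReal)) =
      {((a / 3 + q ^ 2 - 2 * q * ξ : ℝ) : ℂ)
          + (2 * Complex.I / 3) * (Real.sqrt a : ℂ) * ((ξ : ℂ) - (q : ℂ)),
       ((a / 3 + q ^ 2 - 2 * q * ξ : ℝ) : ℂ)
          - (2 * Complex.I / 3) * (Real.sqrt a : ℂ) * ((ξ : ℂ) - (q : ℂ))} := by
  have hs : (Real.sqrt a : ℂ) ^ 2 = a := by exact_mod_cast Real.sq_sqrt ha
  ext μ
  rw [mem_spectrum_fin_two_iff, Set.mem_insert_iff, Set.mem_singleton_iff,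
    ← sub_eq_zero (a := μ), ← sub_eq_zero (a := μ), ← mul_eq_zero]
  refine Eq.congr_left ?_
  simp
  linear_combination (-(4 / 9) * ((ξ : ℂ) - q) ^ 2) * hs
    + ((4 / 9) * ((ξ : ℂ) - q) ^ 2 * (Real.sqrt a : ℂ) ^ 2) * Complex.I_sq


/-- KPI case (`α = −1`): for `ξ ≠ q` the soliton-modulation matrix pencil
`A₁ + ξ A₂` has no real eigenvalue; its eigenvalues over `ℂ` are the non-real
complex-conjugate pair `λ± = a/3 + q² − 2qξ ± (2i/3)√a (ξ − q)`.
Hence the KPI soliton modulation system is elliptic. -/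
theorem KPI_soliton_modulation_elliptic (a q ξ : ℝ) (ha : 0 < a) (hξq : ξ ≠ q) :
    spectrum ℂ
        ((!![a / 3 + q ^ 2, (4 / 3) * q * a;
             -q / 3, a / 3 + q ^ 2] +
           ξ • !![-2 * q, -(4 / 3) * a;
                  1 / 3, -2 * q]).map (Complex.ofReal)) =
      {((a / 3 + q ^ 2 - 2 * q * ξ : ℝ) : ℂ)
          + (2 * Complex.I / 3) * (Real.sqrt a : ℂ) * ((ξ : ℂ) - (q : ℂ)),
       ((a / 3 + q ^ 2 - 2 * q * ξ : ℝ) : ℂ)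
          - (2 * Complex.I / 3) * (Real.sqrt a : ℂ) * ((ξ : ℂ) - (q : ℂ))} ∧
      (((a / 3 + q ^ 2 - 2 * q * ξ : ℝ) : ℂ)
          + (2 * Complex.I / 3) * (Real.sqrt a : ℂ) * ((ξ : ℂ) - (q : ℂ))).im ≠ 0 ∧
      (((a / 3 + q ^ 2 - 2 * q * ξ : ℝ) : ℂ)
          - (2 * Complex.I / 3) * (Real.sqrt a : ℂ) * ((ξ : ℂ) - (q : ℂ)))
        = starRingEnd ℂ (((a / 3 + q ^ 2 - 2 * q * ξ : ℝ) : ℂ)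
          + (2 * Complex.I / 3) * (Real.sqrt a : ℂ) * ((ξ : ℂ) - (q : ℂ))) ∧
      ∀ μ ∈ spectrum ℂ
        ((!![a / 3 + q ^ 2, (4 / 3) * q * a;
             -q / 3, a / 3 + q ^ 2] +
           ξ • !![-2 * q, -(4 / 3) * a;
                  1 / 3, -2 * q]).map (Complex.ofReal)), μ.im ≠ 0 := by
  set lam : ℂ := ((a / 3 + q ^ 2 - 2 * q * ξ : ℝ) : ℂ)
    + (2 * Complex.I / 3) * (Real.sqrt a : ℂ) * ((ξ : ℂ) - (q : ℂ)) with hlam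
  have hspec := spectrum_pencil a q ξ ha.le
  rw [← hlam] at hspec
  have him : lam.im = 2 / 3 * Real.sqrt a * (ξ - q) := by
    simp [hlam, -Complex.ofReal_pow]
  have him0 : lam.im ≠ 0 := by
    rw [him]
    have := (Real.sqrt_pos.2 ha).ne'
    have := sub_ne_zero.2 hξq
    positivity
  have hconj : ((a / 3 + q ^ 2 - 2 * q * ξ : ℝ) : ℂ)
      - (2 * Complex.I / 3) * (Real.sqrt a : ℂ) * ((ξ : ℂ) - (q : ℂ)) = starRingEnd ℂ lam := by
    simp only [hlam, map_add, map_sub, map_mul, map_div₀, Complex.conj_ofReal, Complex.conj_I,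
      map_ofNat]
    ring
  refine ⟨hspec, him0, hconj, ?_⟩
  intro μ hμ
  rw [hspec, hconj] at hμ
  rcases hμ with rfl | rfl
  · exact him0
  · simpa using him0
end

section
/- Let β₁ > 0 and q, ξ ∈ ℝ with ξ ≠ q and β₁ + 2ξ − 4 q ξ + 2 q² ≠ 0. Define the 4×4 real matrices (the KPI Whitham matrices in the solitonic limit β₂ = β₁, β₃ = 0): Ã = [[2β₁/3 + q², 0, 0, 4 q β₁/3], [0, 2β₁/3 + q², 0, 4 q β₁/3], [0, 0, q², 0], [−q/3, −q/3, −q/3, 2β₁/3 + q²]] and B̃ = [[−2q, 0, 0, −4β₁/3], [0, −2q, 0, −4β₁/3], [0, 0, −2q, 0], [1/3, 1/3, 1/3, −2q]]. Then the matrix Ã + ξ B̃, viewed as a complex matrix, has an eigenvalue that is not real; hence the KPI Whitham modulation system is not hyperbolic at the solitonic front. -/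
/-- The KPI Whitham modulation system is not hyperbolic at the solitonic front:
in the solitonic limit `β₂ = β₁ > 0`, `β₃ = 0`, the matrix pencil `Ã + ξ B̃`
(for `ξ ≠ q` with `β₁ + 2ξ − 4qξ + 2q² ≠ 0`) has a non-real eigenvalue. -/
theorem KPI_Whitham_not_hyperbolic (β₁ q ξ : ℝ) (hβ : 0 < β₁) (hξq : ξ ≠ q)
    (hdisc : β₁ + 2 * ξ - 4 * q * ξ + 2 * q ^ 2 ≠ 0) :
    ∃ μ ∈ spectrum ℂ
      (((!![2 * β₁ / 3 + q ^ 2, 0, 0, 4 * q * β₁ / 3;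
            0, 2 * β₁ / 3 + q ^ 2, 0, 4 * q * β₁ / 3;
            0, 0, q ^ 2, 0;
            -q / 3, -q / 3, -q / 3, 2 * β₁ / 3 + q ^ 2] +
          ξ • !![-2 * q, 0, 0, -4 * β₁ / 3;
                 0, -2 * q, 0, -4 * β₁ / 3;
                 0, 0, -2 * q, 0;
                 1 / 3, 1 / 3, 1 / 3, -2 * q] :
          Matrix (Fin 4) (Fin 4) ℝ).map (Complex.ofReal))), μ.im ≠ 0 := by
  obtain ⟨r, hr, rfl⟩ : ∃ r : ℝ, 0 < r ∧ β₁ = r ^ 2 / 2 :=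
    ⟨√(2 * β₁), by positivity, by rw [Real.sq_sqrt (by positivity)]; ring⟩
  have hrC : (r : ℂ) ≠ 0 := by exact_mod_cast hr.ne'
  refine ⟨⟨r ^ 2 / 3 + q ^ 2 - 2 * q * ξ, 2 * r * (q - ξ) / 3⟩, ?_, ?_⟩
  · rw [spectrum.mem_iff, Matrix.isUnit_iff_isUnit_det, isUnit_iff_ne_zero, not_not,
      ← Matrix.exists_mulVec_eq_zero_iff]
    refine ⟨![(r : ℂ), r, 0, Complex.I], fun h => hrC (congrFun h 0), ?_⟩
    ext i
    fin_cases i <;>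
      simp [Matrix.mulVec, dotProduct, Fin.sum_univ_four, Matrix.algebraMap_matrix_apply,
        Complex.ext_iff, pow_two, hr.ne'] <;>
      constructor <;> ring
  · have : q - ξ ≠ 0 := sub_ne_zero.mpr hξq.symm
    have := hr.ne'
    positivity
end
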